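/- Let P be a Markov kernel on a metric space (E, d) with Borel σ-field 𝓔. Assume there exists M ∈ 𝓔 such that μ(M) > 0 for every invariant probability measure μ of P, and such that for every x, y ∈ M there exists α_{x,y} > 0 such that for every ε > 0 there exists a generalized coupling ξ^ε_{x,y} ∈ Ĉ(ℙ_x, ℙ_y) with (ξ^ε_{x,y})*( { (ξ, η) : limsup_{n→∞} (1/n) ∑_{i=0}^{n−1} 𝟙_{[0,ε]}(d(ξ_i, η_i)) ≥ α_{x,y} } ) > 0, where (ξ^ε_{x,y})* denotes the outer measure associated with ξ^ε_{x,y}. Then P has at most one invariant probability measure. -/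

import Mathlib

open MeasureTheory ProbabilityTheory Filter

/-- `μ` is an invariant probability measure of the Markov kernel `P`. -/
def IsInvariantMeasure {E : Type*} [MeasurableSpace E] (P : Kernel E E)
    (μ : Measure E) : Prop :=
  ∀ A : Set E, MeasurableSet A → μ A = ∫⁻ x, P x A ∂μ

/-- Prepend a point to a trajectory. -/
def consTraj {E : Type*} (x : E) (ω : ℕ → E) : ℕ → E :=
  fun n => Nat.casesOn n x ω

/-- `ℙP : E → Measure (ℕ → E)` is the family of laws of the Markov chain with
kernel `P`. -/
def IsChainLaw {E : Type*} [MeasurableSpace E] (P : Kernel E E)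
    (ℙP : E → Measure (ℕ → E)) : Prop :=
  (∀ x, IsProbabilityMeasure (ℙP x)) ∧
    ∀ x, ℙP x = (P x).bind (fun y => (ℙP y).map (consTraj x))

/-- `ξ` is a generalized coupling of `ℙx` and `ℙy`. -/
def IsGeneralizedCoupling {E : Type*} [MeasurableSpace E]
    (ξ : Measure ((ℕ → E) × (ℕ → E))) (ℙx ℙy : Measure (ℕ → E)) : Prop :=
  IsProbabilityMeasure ξ ∧ ξ.map Prod.fst ≪ ℙx ∧ ξ.map Prod.snd ≪ ℙy


/-! ### Maximal ergodic inequality -/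

noncomputable def maxSum {Ω : Type*} (T : Ω → Ω) (g : Ω → ℝ) : ℕ → Ω → ℝ
  | 0 => fun _ => 0
  | n + 1 => fun ω => max 0 (g ω + maxSum T g n (T ω))

lemma maxSum_nonneg {Ω : Type*} (T : Ω → Ω) (g : Ω → ℝ) (n : ℕ) (ω : Ω) :
    0 ≤ maxSum T g n ω := by
  cases n with
  | zero => simp [maxSum]
  | succ n => simp [maxSum]

lemma maxSum_le_succ {Ω : Type*} (T : Ω → Ω) (g : Ω → ℝ) (n : ℕ) :
    ∀ ω : Ω, maxSum T g n ω ≤ maxSum T g (n + 1) ω := by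
  induction n with
  | zero => intro ω; simp [maxSum]
  | succ n ih =>
    intro ω
    have := ih (T ω)
    rw [maxSum, maxSum]
    exact max_le_max le_rfl (by linarith)

lemma maxSum_measurable {Ω : Type*} [MeasurableSpace Ω] {T : Ω → Ω} {g : Ω → ℝ}
    (hT : Measurable T) (hg : Measurable g) (n : ℕ) : Measurable (maxSum T g n) := by
  induction n with
  | zero => exact measurable_const
  | succ n ih =>
    unfold maxSum
    exact measurable_const.max (hg.add (ih.comp hT))

lemma maxSum_bound {Ω : Type*} {T : Ω → Ω} {g : Ω → ℝ} {C : ℝ} (hC : 0 ≤ C)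
    (hg : ∀ ω, g ω ≤ C) (n : ℕ) : ∀ ω, maxSum T g n ω ≤ n * C := by
  induction n with
  | zero => intro ω; simp [maxSum]
  | succ n ih =>
    intro ω
    have := ih (T ω)
    have h2 := hg ω
    rw [maxSum]
    push_cast
    apply max_le
    · positivity
    · linarith

lemma birkhoff_le_maxSum {Ω : Type*} (T : Ω → Ω) (g : Ω → ℝ) (n : ℕ) :
    ∀ ω, birkhoffSum T g n ω ≤ maxSum T g n ω := by
  induction n with
  | zero => intro ω; simp [maxSum]
  | succ n ih =>
    intro ω
    rw [birkhoffSum_succ', maxSum]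
    exact le_max_of_le_right (by linarith [ih (T ω)])

lemma maximal_step {Ω : Type*} [MeasurableSpace Ω] {Q : Measure Ω} [IsProbabilityMeasure Q]
    {T : Ω → Ω} (hT : MeasurePreserving T Q Q) {U : Set Ω} (hU : MeasurableSet U)
    {l : ℝ} (hl : 0 < l) (n : ℕ) :
    l * Q.real {ω | 0 < maxSum T (fun ω => U.indicator (fun _ => (1 : ℝ)) ω - l) n ω}
      ≤ Q.real U := by
  set g : Ω → ℝ := fun ω => U.indicator (fun _ => (1 : ℝ)) ω - l with hgdef
  have hg : Measurable g := (measurable_const.indicator hU).sub_const l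
  have hg1 : ∀ ω, g ω ≤ 1 := by
    intro ω
    simp only [hgdef]
    by_cases h : ω ∈ U <;> simp [h] <;> linarith
  have hm := maxSum_measurable hT.measurable hg n
  set m := maxSum T g n with hmdef
  have hint : Integrable m Q := by
    refine Integrable.of_bound hm.aestronglyMeasurable (n * 1) (ae_of_all _ fun ω => ?_)
    rw [Real.norm_of_nonneg (maxSum_nonneg T g n ω)]
    exact maxSum_bound zero_le_one hg1 n ω
  have hintT : Integrable (fun ω => m (T ω)) Q := (hT.integrable_comp hint.1).2 hint
  have hE : MeasurableSet {ω | 0 < m ω} := measurableSet_lt measurable_const hm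
  set E := {ω | 0 < m ω} with hEdef
  have hiU : Integrable (U.indicator (fun _ => (1 : ℝ))) Q := (integrable_const _).indicator hU
  have hiE : Integrable (E.indicator (fun _ => l)) Q := (integrable_const _).indicator hE
  have key : ∀ ω, m ω + E.indicator (fun _ => l) ω ≤ U.indicator (fun _ => (1 : ℝ)) ω + m (T ω) := by
    intro ω
    have h0 : 0 ≤ m (T ω) := maxSum_nonneg T g n _
    have h1 : 0 ≤ U.indicator (fun _ => (1 : ℝ)) ω := Set.indicator_nonneg (by simp) _
    by_cases h : ω ∈ E
    · rw [Set.indicator_of_mem h]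
      have hpos : 0 < m ω := h
      have h2 : m ω ≤ max 0 (g ω + m (T ω)) := maxSum_le_succ T g n ω
      rcases le_max_iff.1 h2 with h3 | h3
      · linarith
      · have : g ω = U.indicator (fun _ => (1 : ℝ)) ω - l := rfl
        linarith
    · rw [Set.indicator_of_notMem h]
      have : ¬ 0 < m ω := h
      linarith
  have hI := integral_mono (hint.add hiE) (hiU.add hintT) key
  simp only [Pi.add_apply] at hI
  rw [integral_add hint hiE, integral_add hiU hintT, integral_indicator_const _ hE,
    integral_indicator_const _ hU] at hI
  have : ∫ ω, m (T ω) ∂Q = ∫ ω, m ω ∂Q := by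
    have := integral_map (μ := Q) hT.measurable.aemeasurable (f := m)
      (by rw [hT.map_eq]; exact hint.1)
    rw [hT.map_eq] at this
    exact this.symm
  simp only [smul_eq_mul] at hI
  linarith

lemma maximal_ineq {Ω : Type*} [MeasurableSpace Ω] {Q : Measure Ω} [IsProbabilityMeasure Q]
    {T : Ω → Ω} (hT : MeasurePreserving T Q Q) {U : Set Ω} (hU : MeasurableSet U)
    {l : ℝ} (hl : 0 < l) :
    l * Q.real {ω | ∃ n : ℕ, l * n < birkhoffSum T (U.indicator (fun _ => (1 : ℝ))) n ω}
      ≤ Q.real U := by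
  set g : Ω → ℝ := fun ω => U.indicator (fun _ => (1 : ℝ)) ω - l with hgdef
  have hsub : {ω | ∃ n : ℕ, l * n < birkhoffSum T (U.indicator (fun _ => (1 : ℝ))) n ω}
      ⊆ ⋃ n, {ω | 0 < maxSum T g n ω} := by
    rintro ω ⟨n, hn⟩
    refine Set.mem_iUnion.2 ⟨n, lt_of_lt_of_le ?_ (birkhoff_le_maxSum T g n ω)⟩
    have : birkhoffSum T g n ω = birkhoffSum T (U.indicator (fun _ => (1 : ℝ))) n ω - l * n := by
      simp [birkhoffSum, hgdef, Finset.sum_sub_distrib, mul_comm]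
    linarith
  have hmono : Monotone fun n => {ω | 0 < maxSum T g n ω} :=
    monotone_nat_of_le_succ fun n ω h => lt_of_lt_of_le h (maxSum_le_succ T g n ω)
  have hlim := tendsto_measure_iUnion_atTop (μ := Q) hmono
  have hlim2 : Tendsto (fun n => l * Q.real {ω | 0 < maxSum T g n ω}) atTop
      (nhds (l * Q.real (⋃ n, {ω | 0 < maxSum T g n ω}))) :=
    ((ENNReal.tendsto_toReal (measure_ne_top _ _)).comp hlim).const_mul l
  refine le_trans ?_ (le_of_tendsto hlim2 (Eventually.of_forall fun n => maximal_step hT hU hl n))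
  gcongr
  exact measure_ne_top _ _

/-! ### The chain law as a kernel -/

/-- Finite-dimensional rectangles. -/
def rect {E : Type*} (n : ℕ) (A : ℕ → Set E) : Set (ℕ → E) := {ω | ∀ i < n, ω i ∈ A i}

def rects (E : Type*) [MeasurableSpace E] : Set (Set (ℕ → E)) :=
  {S | ∃ (n : ℕ) (A : ℕ → Set E), (∀ i, MeasurableSet (A i)) ∧ S = rect n A}

def shiftTraj {E : Type*} (ω : ℕ → E) : ℕ → E := fun n => ω (n + 1)

lemma shiftTraj_measurable {E : Type*} [MeasurableSpace E] :
    Measurable (shiftTraj : (ℕ → E) → ℕ → E) :=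
  measurable_pi_lambda _ fun n => measurable_pi_apply (n + 1)

lemma consTraj_measurable {E : Type*} [MeasurableSpace E] (x : E) :
    Measurable (consTraj x : (ℕ → E) → ℕ → E) := by
  refine measurable_pi_lambda _ fun n => ?_
  cases n with
  | zero => exact measurable_const
  | succ n => exact measurable_pi_apply n

lemma rect_measurable {E : Type*} [MeasurableSpace E] (n : ℕ) {A : ℕ → Set E}
    (hA : ∀ i, MeasurableSet (A i)) : MeasurableSet (rect n A) := by
  have : rect n A = ⋂ i, ⋂ (_ : i < n), (fun ω : ℕ → E => ω i) ⁻¹' A i := by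
    ext ω; simp [rect]
  rw [this]
  exact MeasurableSet.iInter fun i => MeasurableSet.iInter fun _ => measurable_pi_apply i (hA i)

lemma rects_pi (E : Type*) [MeasurableSpace E] : IsPiSystem (rects E) := by
  rintro _ ⟨n, A, hA, rfl⟩ _ ⟨m, B, hB, rfl⟩ -
  refine ⟨max n m, fun i => (if i < n then A i else Set.univ) ∩ (if i < m then B i else Set.univ),
    fun i => ?_, ?_⟩
  · refine MeasurableSet.inter ?_ ?_
    · split_ifs; exacts [hA i, MeasurableSet.univ]
    · split_ifs; exacts [hB i, MeasurableSet.univ]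
  · ext ω
    simp only [rect, Set.mem_inter_iff]
    constructor
    · rintro ⟨h1, h2⟩ i _
      refine ⟨?_, ?_⟩
      · split_ifs with h; exacts [h1 i h, trivial]
      · split_ifs with h; exacts [h2 i h, trivial]
    · intro h
      refine ⟨fun i hi => ?_, fun i hi => ?_⟩
      · have := (h i (lt_max_of_lt_left hi)).1
        rwa [if_pos hi] at this
      · have := (h i (lt_max_of_lt_right hi)).2
        rwa [if_pos hi] at this

lemma rects_gen (E : Type*) [MeasurableSpace E] :
    (inferInstance : MeasurableSpace (ℕ → E)) = MeasurableSpace.generateFrom (rects E) := by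
  apply le_antisymm
  · refine iSup_le fun i => ?_
    rintro _ ⟨B, hB, rfl⟩
    refine MeasurableSpace.measurableSet_generateFrom
      ⟨i + 1, fun j => if j = i then B else Set.univ, fun j => ?_, ?_⟩
    · dsimp only
      split_ifs; exacts [hB, MeasurableSet.univ]
    · ext ω
      constructor
      · intro h j hj
        show ω j ∈ if j = i then B else Set.univ
        split_ifs with hji
        · subst hji; exact h
        · trivial
      · intro h
        have := h i (Nat.lt_succ_self i)
        simpa using this
  · refine MeasurableSpace.generateFrom_le ?_
    rintro _ ⟨n, A, hA, rfl⟩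
    exact rect_measurable n hA

section chain
variable {E : Type*} [MeasurableSpace E] {P : Kernel E E} {ℙP : E → Measure (ℕ → E)}

lemma chain_aemeas (hℙ : IsChainLaw P ℙP) (x : E) :
    AEMeasurable (fun y => (ℙP y).map (consTraj x)) (P x) := by
  by_contra h
  have h1 := hℙ.2 x
  have := hℙ.1 x
  rw [Measure.bind, Measure.map_of_not_aemeasurable h, Measure.join_zero] at h1
  exact IsProbabilityMeasure.ne_zero (ℙP x) h1

lemma chain_apply (hℙ : IsChainLaw P ℙP) (x : E) {S : Set (ℕ → E)} (hS : MeasurableSet S) :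
    ℙP x S = ∫⁻ y, ℙP y (consTraj x ⁻¹' S) ∂(P x) := by
  conv_lhs => rw [hℙ.2 x]
  rw [Measure.bind_apply hS (chain_aemeas hℙ x)]
  refine lintegral_congr fun y => ?_
  rw [Measure.map_apply (consTraj_measurable x) hS]

lemma cons_rect (x : E) (n : ℕ) (A : ℕ → Set E) (S : Set (ℕ → E)) :
    consTraj x ⁻¹' (S ∩ rect (n + 1) A) =
      {ω | x ∈ A 0 ∧ ω ∈ (consTraj x ⁻¹' S) ∩ rect n (fun i => A (i + 1))} := by
  ext ω
  constructor
  · rintro ⟨h0, h⟩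
    exact ⟨h 0 (Nat.succ_pos _), h0, fun i hi => h (i + 1) (Nat.succ_lt_succ hi)⟩
  · rintro ⟨h0, hS, h⟩
    refine ⟨hS, fun i hi => ?_⟩
    cases i with
    | zero => exact h0
    | succ i => exact h i (Nat.lt_of_succ_lt_succ hi)

lemma chain_rect (hℙ : IsChainLaw P ℙP) (x : E) (n : ℕ) {A : ℕ → Set E}
    (hA : ∀ i, MeasurableSet (A i)) {S : Set (ℕ → E)} (hS : MeasurableSet S)
    (hinv : shiftTraj ⁻¹' S = S) :
    ℙP x (S ∩ rect (n + 1) A) =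
      (A 0).indicator (fun x => ∫⁻ y, ℙP y (S ∩ rect n (fun i => A (i + 1))) ∂(P x)) x := by
  rw [chain_apply hℙ x (hS.inter (rect_measurable _ hA)), cons_rect]
  have : consTraj x ⁻¹' S = S := by
    conv_lhs => rw [← hinv]
    rfl
  rw [this]
  by_cases h : x ∈ A 0
  · simp [h]
  · simp [h]

lemma chain_measurable (hℙ : IsChainLaw P ℙP) : Measurable ℙP := by
  have := hℙ.1
  refine Measurable.measure_of_isPiSystem_of_isProbabilityMeasure (rects_gen E) (rects_pi E) ?_
  rintro _ ⟨n, A, hA, rfl⟩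
  induction n generalizing A with
  | zero =>
    have : rect 0 A = Set.univ := by ext; simp [rect]
    simp [this]
  | succ n ih =>
    have h1 := fun x => chain_rect hℙ x n hA MeasurableSet.univ (by simp)
    simp only [Set.univ_inter] at h1
    simp only [h1]
    exact (Measurable.lintegral_kernel (ih _ fun i => hA (i + 1))).indicator (hA 0)

lemma chain_shift (hℙ : IsChainLaw P ℙP) (x : E) {S : Set (ℕ → E)} (hS : MeasurableSet S) :
    ℙP x (shiftTraj ⁻¹' S) = ∫⁻ y, ℙP y S ∂(P x) := by
  rw [chain_apply hℙ x (shiftTraj_measurable hS)]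
  rfl

lemma invariant_bind {μ : Measure E} (hμ : IsInvariantMeasure P μ) : μ.bind P = μ := by
  ext A hA
  rw [Measure.bind_apply hA P.aemeasurable, ← hμ A hA]

lemma chain_preserving (hℙ : IsChainLaw P ℙP) {μ : Measure E} (hμ : IsInvariantMeasure P μ) :
    MeasurePreserving shiftTraj (μ.bind ℙP) (μ.bind ℙP) := by
  have hm := chain_measurable hℙ
  refine ⟨shiftTraj_measurable, ?_⟩
  ext S hS
  rw [Measure.map_apply shiftTraj_measurable hS,
    Measure.bind_apply (shiftTraj_measurable hS) hm.aemeasurable]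
  simp only [chain_shift hℙ _ hS]
  rw [← Measure.lintegral_bind P.aemeasurable
    (f := fun y => ℙP y S) (((Measure.measurable_coe hS).comp hm).aemeasurable), invariant_bind hμ,
    Measure.bind_apply hS hm.aemeasurable]

/-- Harmonic functions are a.s. constant along the chain. -/
lemma harmonic_const [IsMarkovKernel P] {μ : Measure E} [IsProbabilityMeasure μ]
    (hμ : IsInvariantMeasure P μ)
    {h : E → ℝ} (hm : Measurable h) (h0 : ∀ x, 0 ≤ h x) (h1 : ∀ x, h x ≤ 1)
    (hP : ∀ x, ∫ y, h y ∂(P x) = h x) :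
    ∀ᵐ x ∂μ, ∀ᵐ y ∂(P x), h y = h x := by
  have hb : ∀ (ρ : Measure E) [IsProbabilityMeasure ρ], Integrable h ρ := fun ρ _ =>
    Integrable.of_bound hm.aestronglyMeasurable 1 (ae_of_all _ fun x => by
      rw [Real.norm_of_nonneg (h0 x)]; exact h1 x)
  have hb2 : ∀ (ρ : Measure E) [IsProbabilityMeasure ρ], Integrable (fun x => h x ^ 2) ρ :=
    fun ρ _ => Integrable.of_bound (hm.pow_const 2).aestronglyMeasurable 1
      (ae_of_all _ fun x => by
        rw [Real.norm_of_nonneg (sq_nonneg _)]; exact pow_le_one₀ (h0 x) (h1 x))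
  have hi : ∀ x, Integrable (fun y => (h y - h x) ^ 2) (P x) := fun x =>
    Integrable.of_bound ((hm.sub_const _).pow_const 2).aestronglyMeasurable 1
      (ae_of_all _ fun y => by
        rw [Real.norm_of_nonneg (sq_nonneg _)]
        nlinarith [h0 x, h1 x, h0 y, h1 y])
  have hvar : ∀ x, ∫ y, (h y - h x) ^ 2 ∂(P x) = ∫ y, h y ^ 2 ∂(P x) - h x ^ 2 := by
    intro x
    have e : ∀ y, (h y - h x) ^ 2 = h y ^ 2 - 2 * h x * h y + h x ^ 2 := fun y => by ring
    simp only [e]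
    have hs : Integrable (fun y => h y ^ 2 - 2 * h x * h y) (P x) :=
      (hb2 _).sub ((hb _).const_mul _)
    rw [integral_add hs (integrable_const _), integral_sub (hb2 _) ((hb _).const_mul _), integral_const_mul, hP x]
    simp
    ring
  have hmP : StronglyMeasurable fun x => ∫ y, h y ^ 2 ∂(P x) :=
    (hm.pow_const 2).stronglyMeasurable.integral_kernel
  have hiP : Integrable (fun x => ∫ y, h y ^ 2 ∂(P x)) μ :=
    Integrable.of_bound hmP.aestronglyMeasurable 1 (ae_of_all _ fun x => by
      rw [Real.norm_of_nonneg (integral_nonneg fun y => sq_nonneg _)]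
      have := integral_mono (hb2 (P x)) (integrable_const 1)
        (fun y => pow_le_one₀ (h0 y) (h1 y))
      simpa using this)
  have hz : ∫ x, (∫ y, (h y - h x) ^ 2 ∂(P x)) ∂μ = 0 := by
    simp only [hvar]
    rw [integral_sub hiP (hb2 μ)]
    have hbind : (P ∘ₘ μ) = μ := invariant_bind hμ
    have hc : (P ∘ₖ Kernel.const Unit μ) () = μ := by
      rw [Kernel.comp_apply, Kernel.const_apply]; exact hbind
    have := Kernel.integral_comp (κ := Kernel.const Unit μ) (η := P) (a := ())
      (f := fun x => h x ^ 2) (by rw [hc]; exact hb2 μ)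
    rw [hc, Kernel.const_apply] at this
    linarith
  have hae := (integral_eq_zero_iff_of_nonneg
    (fun x => integral_nonneg fun y => sq_nonneg (h y - h x))
    (by simp only [hvar]; exact hiP.sub (hb2 μ))).1 hz
  filter_upwards [hae] with x hx
  have := (integral_eq_zero_iff_of_nonneg (fun y => sq_nonneg (h y - h x)) (hi x)).1 hx
  filter_upwards [this] with y hy
  have : (h y - h x) ^ 2 = 0 := hy
  have := pow_eq_zero_iff (two_ne_zero) |>.1 this
  linarith

/-- Zero-one law for shift invariant events. -/
lemma zero_one [IsMarkovKernel P] (hℙ : IsChainLaw P ℙP) {μ : Measure E} [IsProbabilityMeasure μ]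
    (hμ : IsInvariantMeasure P μ) {I : Set (ℕ → E)} (hI : MeasurableSet I)
    (hinv : shiftTraj ⁻¹' I = I) :
    ∀ᵐ x ∂μ, ℙP x I = 0 ∨ ℙP x I = 1 := by
  have hp := hℙ.1
  have hm := chain_measurable hℙ
  have hmI : Measurable fun x => ℙP x I := (Measure.measurable_coe hI).comp hm
  have hharm : ∀ x, ∫⁻ y, ℙP y I ∂(P x) = ℙP x I := fun x => by
    rw [← chain_shift hℙ x hI, hinv]
  have hconst : ∀ᵐ x ∂μ, ∀ᵐ y ∂(P x), ℙP y I = ℙP x I := by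
    have := harmonic_const hμ (h := fun x => (ℙP x I).toReal) hmI.ennreal_toReal
      (fun x => ENNReal.toReal_nonneg) (fun x => measureReal_le_one (μ := ℙP x) (s := I))
      (fun x => by
        rw [integral_toReal hmI.aemeasurable (ae_of_all _ fun y => measure_lt_top _ _), hharm])
    filter_upwards [this] with x hx
    filter_upwards [hx] with y hy
    exact (ENNReal.toReal_eq_toReal_iff' (measure_ne_top _ _) (measure_ne_top _ _)).1 hy
  have hae : ∀ {p : E → Prop}, (∀ᵐ x ∂μ, p x) → ∀ᵐ x ∂μ, ∀ᵐ y ∂(P x), p y := by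
    intro p hp
    refine Measure.ae_ae_of_ae_bind P.aemeasurable ?_
    rwa [invariant_bind hμ]
  have hrect : ∀ (n : ℕ) (A : ℕ → Set E), (∀ i, MeasurableSet (A i)) →
      ∀ᵐ x ∂μ, ℙP x (I ∩ rect n A) = ℙP x I * ℙP x (rect n A) := by
    intro n
    induction n with
    | zero =>
      intro A _
      have : rect 0 A = Set.univ := by ext; simp [rect]
      simp [this]
    | succ n ih =>
      intro A hA
      have hA' : ∀ i, MeasurableSet ((fun i => A (i + 1)) i) := fun i => hA (i + 1)
      filter_upwards [hconst, hae (ih _ hA')] with x hx1 hx2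
      have e2 := chain_rect hℙ x n hA MeasurableSet.univ (by simp)
      simp only [Set.univ_inter] at e2
      rw [chain_rect hℙ x n hA hI hinv, e2]
      by_cases h : x ∈ A 0
      · simp only [Set.indicator_of_mem h]
        rw [← lintegral_const_mul (f := fun y => ℙP y (rect n fun i => A (i + 1))) _ ((Measure.measurable_coe (rect_measurable n hA')).comp hm)]
        refine lintegral_congr_ae ?_
        filter_upwards [hx1, hx2] with y h1 h2
        rw [h2, h1]
      · simp [h]
  have hall : ∀ C : Set (ℕ → E), MeasurableSet C →
      ∀ᵐ x ∂μ, ℙP x (I ∩ C) = ℙP x I * ℙP x C := by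
    intro C hC
    induction C, hC using MeasurableSpace.induction_on_inter (rects_gen E) (rects_pi E) with
    | empty => simp
    | basic t ht =>
      obtain ⟨n, A, hA, rfl⟩ := ht
      exact hrect n A hA
    | compl t ht ih =>
      filter_upwards [ih] with x hx
      have e1 := measure_inter_add_sdiff (μ := ℙP x) I ht
      have e2 := measure_add_measure_compl (μ := ℙP x) ht
      rw [measure_univ] at e2
      rw [Set.sdiff_eq, hx] at e1
      have e3 : ℙP x I * ℙP x t + ℙP x (I ∩ tᶜ) = ℙP x I * ℙP x t + ℙP x I * ℙP x tᶜ := by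
        rw [e1, ← mul_add, e2, mul_one]
      exact (ENNReal.add_right_inj
        (ENNReal.mul_ne_top (measure_ne_top _ _) (measure_ne_top _ _))).1 e3
    | iUnion f hd hf ih =>
      filter_upwards [ae_all_iff.2 ih] with x hx
      rw [Set.inter_iUnion, measure_iUnion hd hf, ← ENNReal.tsum_mul_left,
        measure_iUnion _ fun i => hI.inter (hf i)]
      · exact tsum_congr hx
      · intro i j hij
        exact (hd hij).mono Set.inter_subset_right Set.inter_subset_right
  filter_upwards [hall I hI] with x hx
  rw [Set.inter_self] at hx
  have hfin := measure_ne_top (ℙP x) I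
  by_cases h0 : ℙP x I = 0
  · exact Or.inl h0
  · right
    have : ℙP x I * 1 = ℙP x I * ℙP x I := by rw [mul_one]; exact hx
    exact ((ENNReal.mul_right_inj h0 hfin).1 this).symm

end chain

/-! ### Visit counts -/

noncomputable def visits {E : Type*} (U : Set E) (n : ℕ) (ω : ℕ → E) : ℝ :=
  ∑ i ∈ Finset.range n, U.indicator (fun _ => (1 : ℝ)) (ω i)

def oftenSet {E : Type*} (U : Set E) (l : ℝ) : Set (ℕ → E) :=
  {ω | ∀ K : ℕ, ∃ n : ℕ, K + l * n < visits U n ω}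

lemma visits_measurable {E : Type*} [MeasurableSpace E] {U : Set E} (hU : MeasurableSet U) (n : ℕ) :
    Measurable (visits U n) := by
  unfold visits
  exact Finset.measurable_sum _ fun i _ =>
    (measurable_const.indicator hU).comp (measurable_pi_apply i)

lemma oftenSet_measurable {E : Type*} [MeasurableSpace E] {U : Set E} (hU : MeasurableSet U)
    (l : ℝ) : MeasurableSet (oftenSet U l) := by
  have : oftenSet U l = ⋂ K : ℕ, ⋃ n : ℕ, {ω | K + l * n < visits U n ω} := by
    ext ω; simp [oftenSet]
  rw [this]
  exact MeasurableSet.iInter fun K => MeasurableSet.iUnion fun n =>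
    measurableSet_lt measurable_const (visits_measurable hU n)

lemma visits_shift {E : Type*} (U : Set E) (n : ℕ) (ω : ℕ → E) :
    visits U (n + 1) ω = visits U n (shiftTraj ω) + U.indicator (fun _ => (1 : ℝ)) (ω 0) := by
  unfold visits
  rw [Finset.sum_range_succ']
  rfl

lemma indicator_bounds {E : Type*} (U : Set E) (x : E) :
    0 ≤ U.indicator (fun _ => (1 : ℝ)) x ∧ U.indicator (fun _ => (1 : ℝ)) x ≤ 1 := by
  by_cases h : x ∈ U <;> simp [h]

lemma oftenSet_shift {E : Type*} (U : Set E) {l : ℝ} (h0 : 0 ≤ l) (h1 : l ≤ 1) :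
    shiftTraj ⁻¹' (oftenSet U l) = oftenSet U l := by
  ext ω
  have hb := indicator_bounds U (ω 0)
  constructor
  · intro h K
    obtain ⟨n, hn⟩ := h (K + 1)
    refine ⟨n + 1, ?_⟩
    rw [visits_shift]
    push_cast at hn ⊢
    linarith
  · intro h K
    obtain ⟨n, hn⟩ := h (K + 1)
    cases n with
    | zero =>
      simp [visits] at hn
      have : (0 : ℝ) ≤ K := K.cast_nonneg
      linarith
    | succ n =>
      refine ⟨n, ?_⟩
      rw [visits_shift] at hn
      push_cast at hn
      linarith

lemma birkhoff_visits {E : Type*} (U : Set E) (n : ℕ) (ω : ℕ → E) :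
    birkhoffSum shiftTraj (((fun ω : ℕ → E => ω 0) ⁻¹' U).indicator (fun _ => (1 : ℝ))) n ω
      = visits U n ω := by
  have hit : ∀ i : ℕ, ∀ ω : ℕ → E, (shiftTraj^[i] ω) 0 = ω i := by
    have : ∀ i : ℕ, ∀ ω : ℕ → E, ∀ j, (shiftTraj^[i] ω) j = ω (j + i) := by
      intro i
      induction i with
      | zero => intro ω j; rfl
      | succ i ih =>
        intro ω j
        rw [Function.iterate_succ_apply, ih]
        rfl
    intro i ω
    rw [this, zero_add]
  unfold birkhoffSum visits
  refine Finset.sum_congr rfl fun i _ => ?_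
  by_cases h : ω i ∈ U
  · rw [Set.indicator_of_mem h, Set.indicator_of_mem]
    show (shiftTraj^[i] ω) 0 ∈ U
    rwa [hit]
  · rw [Set.indicator_of_notMem h, Set.indicator_of_notMem]
    show ¬ (shiftTraj^[i] ω) 0 ∈ U
    rwa [hit]

section
variable {E : Type*} [MeasurableSpace E] {P : Kernel E E} {ℙP : E → Measure (ℕ → E)}

lemma chain_zero (hℙ : IsChainLaw P ℙP) [IsMarkovKernel P] (x : E) {U : Set E} (hU : MeasurableSet U) :
    ℙP x ((fun ω : ℕ → E => ω 0) ⁻¹' U) = U.indicator (fun _ => 1) x := by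
  have := hℙ.1
  rw [chain_apply hℙ x (measurable_pi_apply 0 hU)]
  by_cases h : x ∈ U
  · have : (consTraj x ⁻¹' ((fun ω : ℕ → E => ω 0) ⁻¹' U)) = Set.univ :=
      Set.eq_univ_of_forall fun ω => h
    simp [this, h]
  · have : (consTraj x ⁻¹' ((fun ω : ℕ → E => ω 0) ⁻¹' U)) = ∅ :=
      Set.eq_empty_of_forall_notMem fun ω => h
    simp [this, h]

lemma often_bound [IsMarkovKernel P] (hℙ : IsChainLaw P ℙP) {μ : Measure E}
    [IsProbabilityMeasure μ] (hμ : IsInvariantMeasure P μ) {U : Set E} (hU : MeasurableSet U)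
    {l : ℝ} (h0 : 0 < l) (h1 : l ≤ 1) :
    μ {x | ℙP x (oftenSet U l) ≠ 0} ≤ μ U / ENNReal.ofReal l := by
  have hp := hℙ.1
  have hm := chain_measurable hℙ
  have hI := oftenSet_measurable hU l
  have hmI : Measurable fun x => ℙP x (oftenSet U l) := (Measure.measurable_coe hI).comp hm
  have hz := zero_one hℙ hμ hI (oftenSet_shift U h0.le h1)
  have hU0 : MeasurableSet ((fun ω : ℕ → E => ω 0) ⁻¹' U) := measurable_pi_apply 0 hU
  have hQ : IsProbabilityMeasure (μ.bind ℙP) := ⟨by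
    rw [Measure.bind_apply MeasurableSet.univ hm.aemeasurable]; simp⟩
  have hB : MeasurableSet {x | ℙP x (oftenSet U l) ≠ 0} :=
    (hmI (measurableSet_singleton 0)).compl
  have e1 : μ {x | ℙP x (oftenSet U l) ≠ 0} = (μ.bind ℙP) (oftenSet U l) := by
    rw [Measure.bind_apply hI hm.aemeasurable, ← lintegral_indicator_one hB]
    refine lintegral_congr_ae ?_
    filter_upwards [hz] with x hx
    rcases hx with hx | hx
    · rw [Set.indicator_of_notMem, hx]
      exact fun h => h hx
    · rw [Set.indicator_of_mem, hx]; rfl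
      show ℙP x (oftenSet U l) ≠ 0
      rw [hx]; exact one_ne_zero
  have e2 : (μ.bind ℙP) ((fun ω : ℕ → E => ω 0) ⁻¹' U) = μ U := by
    rw [Measure.bind_apply hU0 hm.aemeasurable]
    simp only [chain_zero hℙ _ hU]
    exact lintegral_indicator_one hU
  have e3 := maximal_ineq (chain_preserving hℙ hμ) hU0 h0
  simp only [birkhoff_visits] at e3
  have e4 : l * (μ.bind ℙP).real (oftenSet U l) ≤ μ.real U := by
    rw [measureReal_def, measureReal_def, ← e2]
    refine le_trans ?_ e3
    refine mul_le_mul_of_nonneg_left ?_ h0.le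
    refine measureReal_mono ?_ 
    intro ω hω
    obtain ⟨n, hn⟩ := hω 0
    exact ⟨n, by simpa using hn⟩
  rw [e1, ENNReal.le_div_iff_mul_le (by simp [h0]) (by simp)]
  rw [← ENNReal.toReal_le_toReal (by finiteness) (by finiteness), ENNReal.toReal_mul,
    ENNReal.toReal_ofReal h0.le, mul_comm]
  exact e4

lemma often_ae [IsMarkovKernel P] (hℙ : IsChainLaw P ℙP) {μ : Measure E}
    [IsProbabilityMeasure μ] (hμ : IsInvariantMeasure P μ) {U : ℕ → Set E}
    (hU : ∀ k, MeasurableSet (U k)) (hlim : Tendsto (fun k => μ (U k)) atTop (nhds 0))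
    {l : ℝ} (h0 : 0 < l) (h1 : l ≤ 1) :
    ∀ᵐ x ∂μ, ∃ k, ℙP x (oftenSet (U k) l) = 0 := by
  have h2 : Tendsto (fun k => μ (U k) / ENNReal.ofReal l) atTop (nhds 0) := by
    have := ENNReal.Tendsto.div_const hlim (b := ENNReal.ofReal l) (Or.inr (by simp [h0]))
    simpa using this
  have h3 : μ {x | ¬ ∃ k, ℙP x (oftenSet (U k) l) = 0} ≤ 0 := by
    refine ge_of_tendsto' h2 fun k => le_trans (measure_mono ?_) (often_bound hℙ hμ (hU k) h0 h1)
    intro x hx h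
    exact hx ⟨k, h⟩
  exact le_antisymm h3 zero_le

lemma sub_invariant [IsMarkovKernel P] {μ ν : Measure E} [IsFiniteMeasure μ] [IsFiniteMeasure ν]
    (hμ : IsInvariantMeasure P μ) (hν : IsInvariantMeasure P ν) :
    IsInvariantMeasure P (μ - ν) := by
  have hle : μ - ν ≤ (μ - ν).bind P := by
    rw [Measure.sub_le_iff_le_add]
    have h1 : μ ≤ (μ - ν) + ν := Measure.sub_le_iff_le_add.1 le_rfl
    refine Measure.le_iff.2 fun A hA => ?_
    rw [Measure.add_apply, Measure.bind_apply hA P.aemeasurable, hμ A hA, hν A hA,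
      ← lintegral_add_measure]
    exact lintegral_mono' h1 le_rfl
  have huniv : ((μ - ν).bind P) Set.univ = (μ - ν) Set.univ := by
    rw [Measure.bind_apply MeasurableSet.univ P.aemeasurable]
    simp
  have hfin : IsFiniteMeasure ((μ - ν).bind P) := ⟨by rw [huniv]; exact measure_lt_top _ _⟩
  have heq : μ - ν = (μ - ν).bind P :=
    Measure.eq_of_le_of_measure_univ_eq hle huniv.symm
  intro A hA
  conv_lhs => rw [heq]
  rw [Measure.bind_apply hA P.aemeasurable]

lemma normalize_invariant {ρ : Measure E} [IsFiniteMeasure ρ] (hρ0 : ρ ≠ 0)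
    (hρ : IsInvariantMeasure P ρ) :
    IsProbabilityMeasure ((ρ Set.univ)⁻¹ • ρ) ∧ IsInvariantMeasure P ((ρ Set.univ)⁻¹ • ρ) := by
  have : NeZero ρ := ⟨hρ0⟩
  refine ⟨inferInstance, fun A hA => ?_⟩
  rw [Measure.smul_apply, lintegral_smul_measure, hρ A hA]

end

lemma sub_ne_zero' {E : Type*} [MeasurableSpace E] {μ ν : Measure E} [IsProbabilityMeasure μ]
    [IsProbabilityMeasure ν] (h : μ ≠ ν) : μ - ν ≠ 0 := by
  intro h0
  have h1 : μ ≤ 0 + ν := Measure.sub_le_iff_le_add.1 h0.le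
  rw [zero_add] at h1
  exact h (Measure.eq_of_le_of_measure_univ_eq h1 (by simp))

lemma freq_contra {E : Type*} [MetricSpace E] {U V : Set E} {ε α l : ℝ} (hα : 0 < α)
    (hl : l < α / 4)
    (hUV : ∀ a b, dist a b ≤ ε → a ∈ U ∨ b ∈ V) {p : (ℕ → E) × (ℕ → E)}
    (hp : α ≤ limsup (fun n : ℕ =>
          (∑ i ∈ Finset.range n,
            if dist (p.1 i) (p.2 i) ≤ ε then (1 : ℝ) else 0) / n) atTop) :
    p.1 ∈ oftenSet U l ∨ p.2 ∈ oftenSet V l := by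
  by_contra hcon
  push Not at hcon
  obtain ⟨h1, h2⟩ := hcon
  simp only [oftenSet] at h1 h2
  have h1' : ∃ K : ℕ, ∀ n : ℕ, visits U n p.1 ≤ K + l * n := by
    by_contra h; push Not at h; exact h1 h
  have h2' : ∃ K : ℕ, ∀ n : ℕ, visits V n p.2 ≤ K + l * n := by
    by_contra h; push Not at h; exact h2 h
  obtain ⟨K, hK⟩ := h1'
  obtain ⟨L, hL⟩ := h2'
  have hsum : ∀ n : ℕ, (∑ i ∈ Finset.range n,
      if dist (p.1 i) (p.2 i) ≤ ε then (1 : ℝ) else 0) ≤ visits U n p.1 + visits V n p.2 := by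
    intro n
    unfold visits
    rw [← Finset.sum_add_distrib]
    refine Finset.sum_le_sum fun i _ => ?_
    have b1 := indicator_bounds U (p.1 i)
    have b2 := indicator_bounds V (p.2 i)
    split_ifs with h
    · rcases hUV _ _ h with h | h
      · rw [Set.indicator_of_mem h]; linarith
      · rw [Set.indicator_of_mem h (s := V)]; linarith
    · linarith
  have hfr : ∃ᶠ n : ℕ in atTop, α * (3 / 4) < (∑ i ∈ Finset.range n,
      if dist (p.1 i) (p.2 i) ≤ ε then (1 : ℝ) else 0) / n := by
    refine frequently_lt_of_lt_limsup ?_ (lt_of_lt_of_le (by linarith) hp)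
    refine ⟨0, ?_⟩
    intro a ha
    obtain ⟨n, hn⟩ := (Filter.eventually_map.1 ha).exists
    refine le_trans ?_ hn
    positivity
  have hev : ∀ᶠ n : ℕ in atTop, (K + L : ℝ) / (α / 4) < n :=
    tendsto_natCast_atTop_atTop.eventually_gt_atTop _
  obtain ⟨n, hn1, hn2, hn3⟩ := (hfr.and_eventually (hev.and (eventually_gt_atTop 0))).exists
  have hnpos : (0 : ℝ) < n := by exact_mod_cast hn3
  rw [lt_div_iff₀ hnpos] at hn1
  rw [div_lt_iff₀ (by positivity)] at hn2
  have := hsum n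
  have := hK n
  have := hL n
  nlinarith

/-- Corollary, metric case: if there is a Borel set `M` charged by every
invariant probability measure such that every pair of starting points in `M`
admits generalized couplings keeping the trajectories `ε`-close with positive
limiting frequency (with positive outer probability), then the Markov kernel
`P` has at most one invariant probability measure. -/
theorem unique_invariant_measure_of_generalized_couplings
    {E : Type*} [MetricSpace E] [MeasurableSpace E] [BorelSpace E]
    (P : Kernel E E) [IsMarkovKernel P]
    (ℙP : E → Measure (ℕ → E)) (hℙ : IsChainLaw P ℙP)
    (M : Set E) (hM : MeasurableSet M)
    (hMpos : ∀ μ : Measure E, IsProbabilityMeasure μ → IsInvariantMeasure P μ →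
      0 < μ M)
    (hcoup : ∀ x ∈ M, ∀ y ∈ M, ∃ α > (0 : ℝ), ∀ ε > (0 : ℝ),
      ∃ ξ : Measure ((ℕ → E) × (ℕ → E)), IsGeneralizedCoupling ξ (ℙP x) (ℙP y) ∧
        0 < ξ {p : (ℕ → E) × (ℕ → E) | α ≤ limsup (fun n : ℕ =>
          (∑ i ∈ Finset.range n,
            if dist (p.1 i) (p.2 i) ≤ ε then (1 : ℝ) else 0) / n) atTop}) :
    ∀ μ ν : Measure E, IsProbabilityMeasure μ → IsProbabilityMeasure ν →
      IsInvariantMeasure P μ → IsInvariantMeasure P ν → μ = ν := by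
  intro μ ν hμp hνp hμ hν
  by_contra hne
  obtain ⟨hp1, hi1⟩ := normalize_invariant (sub_ne_zero' hne) (sub_invariant hμ hν)
  obtain ⟨hp2, hi2⟩ := normalize_invariant (sub_ne_zero' (Ne.symm hne)) (sub_invariant hν hμ)
  have hsing : (((μ - ν) Set.univ)⁻¹ • (μ - ν)).MutuallySingular
      (((ν - μ) Set.univ)⁻¹ • (ν - μ)) := by
    have h := Measure.mutually_singular_measure_sub (μ := μ) (ν := ν)
    exact ((h.smul _).symm.smul _).symm
  generalize ((μ - ν) Set.univ)⁻¹ • (μ - ν) = μ1 at hp1 hi1 hsing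
  generalize ((ν - μ) Set.univ)⁻¹ • (ν - μ) = ν1 at hp2 hi2 hsing
  obtain ⟨s, hs, hs1, hs2⟩ := hsing
  have hF : ∀ k : ℕ, ∃ F : Set E, F ⊆ sᶜ ∧ IsClosed F ∧ μ1 (sᶜ \ F) < ((k : ENNReal) + 1)⁻¹ := by
    intro k
    exact hs.compl.exists_isClosed_sdiff_lt (measure_ne_top _ _) (by simp)
  choose F hFs hFc hFm using hF
  have hlim : Tendsto (fun k : ℕ => ((k : ENNReal) + 1)⁻¹) atTop (nhds 0) := by
    have h := (tendsto_add_atTop_iff_nat 1).2 ENNReal.tendsto_inv_nat_nhds_zero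
    simpa using h
  have hUlim : Tendsto (fun k => μ1 (F k)ᶜ) atTop (nhds 0) := by
    refine tendsto_of_tendsto_of_tendsto_of_le_of_le tendsto_const_nhds hlim
      (fun k => zero_le) (fun k => ?_)
    have hsub : (F k)ᶜ ⊆ s ∪ (sᶜ \ F k) := by
      intro x hx
      by_cases h : x ∈ s
      · exact Or.inl h
      · exact Or.inr ⟨h, hx⟩
    calc μ1 (F k)ᶜ ≤ μ1 s + μ1 (sᶜ \ F k) := (measure_mono hsub).trans (measure_union_le _ _)
      _ ≤ _ := by rw [hs1, zero_add]; exact (hFm k).le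
  have hVlim : ∀ k, Tendsto (fun m : ℕ => ν1 (Metric.thickening (1 / ((m : ℝ) + 1)) (F k)))
      atTop (nhds 0) := by
    intro k
    have h0 : ν1 (F k) = 0 := measure_mono_null (hFs k) hs2
    have h := tendsto_measure_thickening_of_isClosed (μ := ν1)
      ⟨1, one_pos, measure_ne_top _ _⟩ (hFc k)
    rw [h0] at h
    refine h.comp (tendsto_nhdsWithin_iff.2
      ⟨tendsto_one_div_add_atTop_nhds_zero_nat, Eventually.of_forall fun m => ?_⟩)
    show (0 : ℝ) < 1 / ((m : ℝ) + 1)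
    positivity
  have hl0 : ∀ j : ℕ, 0 < 1 / ((j : ℝ) + 1) := fun j => Nat.one_div_pos_of_nat
  have hl1 : ∀ j : ℕ, 1 / ((j : ℝ) + 1) ≤ 1 := fun j => by
    rw [div_le_one (by positivity)]
    have : (0 : ℝ) ≤ j := j.cast_nonneg
    linarith
  have hae1 : ∀ᵐ x ∂μ1, ∀ j : ℕ, ∃ k, ℙP x (oftenSet (F k)ᶜ (1 / ((j : ℝ) + 1))) = 0 :=
    ae_all_iff.2 fun j => often_ae hℙ hi1 (fun k => (hFc k).measurableSet.compl) hUlim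
      (hl0 j) (hl1 j)
  have hae2 : ∀ᵐ y ∂ν1, ∀ j k : ℕ, ∃ m : ℕ,
      ℙP y (oftenSet (Metric.thickening (1 / ((m : ℝ) + 1)) (F k)) (1 / ((j : ℝ) + 1))) = 0 :=
    ae_all_iff.2 fun j => ae_all_iff.2 fun k =>
      often_ae hℙ hi2 (fun m => Metric.isOpen_thickening.measurableSet) (hVlim k) (hl0 j) (hl1 j)
  have hex : ∀ (ρ : Measure E) (q : E → Prop), 0 < ρ M → (∀ᵐ x ∂ρ, q x) → ∃ x ∈ M, q x := by
    intro ρ q hρ hq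
    by_contra hno
    push Not at hno
    exact hρ.ne' (measure_mono_null (fun x hx => hno x hx) hq)
  obtain ⟨x, hxM, hx⟩ := hex μ1 _ (hMpos μ1 hp1 hi1) hae1
  obtain ⟨y, hyM, hy⟩ := hex ν1 _ (hMpos ν1 hp2 hi2) hae2
  obtain ⟨α, hα, hc⟩ := hcoup x hxM y hyM
  obtain ⟨j, hj⟩ := exists_nat_one_div_lt (show 0 < α / 4 by positivity)
  obtain ⟨k, hk⟩ := hx j
  obtain ⟨m, hm⟩ := hy j k
  obtain ⟨ξ, ⟨hξp, hξ1, hξ2⟩, hξ⟩ := hc (1 / ((m : ℝ) + 1) / 2) (half_pos (hl0 m))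
  have n1 : ξ (Prod.fst ⁻¹' oftenSet (F k)ᶜ (1 / ((j : ℝ) + 1))) = 0 := by
    rw [← Measure.map_apply measurable_fst
      (oftenSet_measurable (hFc k).measurableSet.compl _)]
    exact hξ1 hk
  have n2 : ξ (Prod.snd ⁻¹' oftenSet (Metric.thickening (1 / ((m : ℝ) + 1)) (F k))
      (1 / ((j : ℝ) + 1))) = 0 := by
    rw [← Measure.map_apply measurable_snd
      (oftenSet_measurable Metric.isOpen_thickening.measurableSet _)]
    exact hξ2 hm
  refine hξ.ne' (measure_mono_null (fun p hp => ?_) (measure_union_null n1 n2))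
  refine freq_contra (U := (F k)ᶜ) (V := Metric.thickening (1 / ((m : ℝ) + 1)) (F k)) hα hj ?_ hp
  intro a b hab
  by_cases ha : a ∈ F k
  · right
    rw [Metric.mem_thickening_iff]
    refine ⟨a, ha, ?_⟩
    rw [dist_comm]
    exact lt_of_le_of_lt hab (half_lt_self (hl0 m))
  · exact Or.inl ha
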